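/- arXiv:1806.04561 — 5 statements merged into one kernel-verified Lean document; each statement's English description precedes it below -/
import Mathlib

section
/- Let n be a positive integer, let D be a nonempty subset of ℝ^n, let ε ∈ (0,1), and let Λ be a self-adjoint positive-definite linear operator on ℝ^n satisfying θ·Id ⪯ Λ ⪯ φ·Id with θ, φ ∈ [ε, 1−ε]. Let R : D → ℝ^n be nonexpansive and let T_Λ := (Id − Λ) + Λ∘R, i.e. T_Λ(x) = x + Λ(R(x) − x). Then for all x, y ∈ D, ⟪Λ⁻¹(T_Λ(x) − T_Λ(y)), T_Λ(x) − T_Λ(y)⟫ ≤ ⟪Λ⁻¹(x − y), x − y⟫ − ((1−φ)/φ)·⟪Λ⁻¹((x − T_Λ(x)) − (y − T_Λ(y))), (x − T_Λ(x)) − (y − T_Λ(y))⟫; that is, T_Λ is φ-averaged in the metric induced by Λ⁻¹. -/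
open scoped RealInnerProductSpace

/-- An operator-weighted averaged operator `T_Λ = (Id - Λ) + Λ∘R`,
with `R` nonexpansive on `D` and `θ·Id ⪯ Λ ⪯ φ·Id` self-adjoint (θ, φ ∈ [ε, 1-ε]),
is φ-averaged in the metric induced by `Λ⁻¹`.  The inverse `Λ⁻¹` is encoded by
quantifying over preimages: `Λ a = v` means `a = Λ⁻¹ v`. -/
theorem statement0
    (n : ℕ) (hn : 0 < n)
    (D : Set (EuclideanSpace ℝ (Fin n))) (hD : D.Nonempty)
    (ε : ℝ) (hε : ε ∈ Set.Ioo (0 : ℝ) 1)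
    (θ φ : ℝ) (hθ : θ ∈ Set.Icc ε (1 - ε)) (hφ : φ ∈ Set.Icc ε (1 - ε))
    (Λ : EuclideanSpace ℝ (Fin n) →ₗ[ℝ] EuclideanSpace ℝ (Fin n))
    (hΛsa : ∀ z w, ⟪Λ z, w⟫ = ⟪z, Λ w⟫)
    (hΛlow : ∀ z, θ * ‖z‖ ^ 2 ≤ ⟪Λ z, z⟫)
    (hΛup : ∀ z, ⟪Λ z, z⟫ ≤ φ * ‖z‖ ^ 2)
    (R : EuclideanSpace ℝ (Fin n) → EuclideanSpace ℝ (Fin n))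
    (hR : ∀ x ∈ D, ∀ y ∈ D, ‖R x - R y‖ ≤ ‖x - y‖)
    (T : EuclideanSpace ℝ (Fin n) → EuclideanSpace ℝ (Fin n))
    (hT : ∀ x, T x = x + Λ (R x - x)) :
    ∀ x ∈ D, ∀ y ∈ D, ∀ a b c : EuclideanSpace ℝ (Fin n),
      Λ a = T x - T y → Λ b = x - y → Λ c = (x - T x) - (y - T y) →
      ⟪a, T x - T y⟫ ≤
        ⟪b, x - y⟫ - (1 - φ) / φ * ⟪c, (x - T x) - (y - T y)⟫ := by
  intro x hx y hy a b c ha hb hc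
  have hθ0 : 0 < θ := hε.1.trans_le hθ.1
  have hφ0 : 0 < φ := hε.1.trans_le hφ.1
  have hker : ∀ z, Λ z = 0 → z = 0 := by
    intro z hz
    have h := hΛlow z
    rw [hz, inner_zero_left] at h
    have hsq : ‖z‖ ^ 2 = 0 := le_antisymm (nonpos_of_mul_nonpos_right h hθ0) (sq_nonneg _)
    simpa using hsq
  set d := x - y with hd
  set w := d - (R x - R y) with hw
  have hΛw : Λ w = (x - T x) - (y - T y) := by
    rw [hT, hT, hw, hd]
    simp only [map_sub]
    abel
  have hcw : c = w := sub_eq_zero.mp (hker _ (by rw [map_sub, hc, hΛw, sub_self]))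
  have hTd : T x - T y = d - Λ w := by
    rw [hΛw, hd]
    abel
  have hab : a = b - w :=
    sub_eq_zero.mp (hker _ (by rw [map_sub, map_sub, ha, hb, hTd, sub_self]))
  have hbw : ⟪b, Λ w⟫ = ⟪w, d⟫ := by
    rw [← hΛsa, hb, real_inner_comm]
  have hnorm : ‖w‖ ^ 2 ≤ 2 * ⟪w, d⟫ := by
    have hsq : ‖d - w‖ ^ 2 ≤ ‖d‖ ^ 2 := by
      have h : d - w = R x - R y := by rw [hw, sub_sub_cancel]
      rw [h]
      exact pow_le_pow_left₀ (norm_nonneg _) (hR x hx y hy) 2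
    rw [norm_sub_sq_real, real_inner_comm] at hsq
    linarith
  have hquad : ⟪w, Λ w⟫ / φ ≤ 2 * ⟪w, d⟫ := by
    refine le_trans ?_ hnorm
    rw [div_le_iff₀ hφ0, ← hΛsa, mul_comm]
    exact hΛup w
  have hcoef : (1 - φ) / φ * ⟪w, Λ w⟫ = ⟪w, Λ w⟫ / φ - ⟪w, Λ w⟫ := by
    field_simp
  rw [← hΛw, hTd, hab, hcw, hcoef]
  simp only [inner_sub_left, inner_sub_right]
  rw [hbw]
  linarith
end

section
/- Let n be a positive integer, let D be a nonempty subset of ℝ^n, let ε ∈ (0,1), and let Λ be a self-adjoint positive-definite linear operator on ℝ^n satisfying θ·Id ⪯ Λ ⪯ φ·Id with θ, φ ∈ [ε, 1−ε]. Let R : D → ℝ^n be nonexpansive with a fixed point y ∈ D (R(y) = y), and let T_Λ(x) := x + Λ(R(x) − x). Then for every x ∈ D, ⟪Λ⁻¹(T_Λ(x) − y), T_Λ(x) − y⟫ ≤ ⟪Λ⁻¹(x − y), x − y⟫ − ((1−φ)/φ)·⟪Λ⁻¹(x − T_Λ(x)), x − T_Λ(x)⟫. In particular ‖T_Λ(x)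 − y‖_{Λ⁻¹} ≤ ‖x − y‖_{Λ⁻¹}. -/
open scoped RealInnerProductSpace

/-- A linear map whose quadratic form is bounded below by a positive multiple of the squared norm
is injective. -/
lemma injective_of_coercive {E : Type*} [NormedAddCommGroup E] [InnerProductSpace ℝ E]
    {Λ : E →ₗ[ℝ] E} {θ : ℝ} (hθ : 0 < θ) (hΛ : ∀ z, θ * ‖z‖ ^ 2 ≤ ⟪Λ z, z⟫) :
    Function.Injective Λ := by
  refine (injective_iff_map_eq_zero Λ).2 fun z hz => ?_
  have h := hΛ z
  rw [hz, inner_zero_left] at h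
  have hsq : ‖z‖ ^ 2 = 0 := le_antisymm (nonpos_of_mul_nonpos_right h hθ) (sq_nonneg _)
  simpa using hsq

/-- If moving from `u` by `r` does not increase the norm, then `2⟪r, u⟫ ≤ -‖r‖²`. -/
lemma two_mul_inner_le_of_norm_add_le {E : Type*} [NormedAddCommGroup E] [InnerProductSpace ℝ E]
    {r u : E} (h : ‖r + u‖ ≤ ‖u‖) : 2 * ⟪r, u⟫ ≤ -‖r‖ ^ 2 := by
  have hsq : ‖r + u‖ ^ 2 ≤ ‖u‖ ^ 2 := by gcongr
  rw [norm_add_sq_real] at hsq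
  linarith

/-- Decrease of the quadratic form of `Λ` along a step `r` satisfying `2⟪r, Λ b⟫ ≤ -‖r‖²`. -/
lemma inner_map_add_le {E : Type*} [NormedAddCommGroup E] [InnerProductSpace ℝ E]
    {Λ : E →ₗ[ℝ] E} (hΛ : Λ.IsSymmetric) {φ : ℝ} (hφ : 0 < φ) {b r : E}
    (hup : ⟪Λ r, r⟫ ≤ φ * ‖r‖ ^ 2) (hr : 2 * ⟪r, Λ b⟫ ≤ -‖r‖ ^ 2) :
    ⟪b + r, Λ (b + r)⟫ ≤ ⟪b, Λ b⟫ - (1 - φ) / φ * ⟪r, Λ r⟫ := by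
  have hbr : ⟪b, Λ r⟫ = ⟪r, Λ b⟫ := by rw [← hΛ b r, real_inner_comm]
  have hdiv : ⟪r, Λ r⟫ / φ ≤ ‖r‖ ^ 2 := by
    rw [div_le_iff₀ hφ, real_inner_comm]
    linarith
  have hcoef : (1 - φ) / φ * ⟪r, Λ r⟫ = ⟪r, Λ r⟫ / φ - ⟪r, Λ r⟫ := by
    field_simp
  rw [map_add, inner_add_left, inner_add_right, inner_add_right, hbr, hcoef]
  linarith

/-- For an operator-weighted averaged operator `T_Λ(x) = x + Λ(R x - x)`
with `R` nonexpansive on `D` having a fixed point `y ∈ D`, and `θ·Id ⪯ Λ ⪯ φ·Id`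
self-adjoint with `θ, φ ∈ [ε, 1-ε]`, one has the contractive inequality towards the
fixed point in the metric induced by `Λ⁻¹`, and in particular
`‖T_Λ(x) - y‖_{Λ⁻¹} ≤ ‖x - y‖_{Λ⁻¹}`.  The inverse `Λ⁻¹` is encoded by quantifying
over preimages: `Λ a = v` means `a = Λ⁻¹ v`. -/
theorem statement1
    (n : ℕ) (hn : 0 < n)
    (D : Set (EuclideanSpace ℝ (Fin n))) (hD : D.Nonempty)
    (ε : ℝ) (hε : ε ∈ Set.Ioo (0 : ℝ) 1)
    (θ φ : ℝ) (hθ : θ ∈ Set.Icc ε (1 - ε)) (hφ : φ ∈ Set.Icc ε (1 - ε))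
    (Λ : EuclideanSpace ℝ (Fin n) →ₗ[ℝ] EuclideanSpace ℝ (Fin n))
    (hΛsa : ∀ z w, ⟪Λ z, w⟫ = ⟪z, Λ w⟫)
    (hΛlow : ∀ z, θ * ‖z‖ ^ 2 ≤ ⟪Λ z, z⟫)
    (hΛup : ∀ z, ⟪Λ z, z⟫ ≤ φ * ‖z‖ ^ 2)
    (R : EuclideanSpace ℝ (Fin n) → EuclideanSpace ℝ (Fin n))
    (hR : ∀ x ∈ D, ∀ y ∈ D, ‖R x - R y‖ ≤ ‖x - y‖)
    (y : EuclideanSpace ℝ (Fin n)) (hy : y ∈ D) (hfix : R y = y)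
    (T : EuclideanSpace ℝ (Fin n) → EuclideanSpace ℝ (Fin n))
    (hT : ∀ x, T x = x + Λ (R x - x)) :
    ∀ x ∈ D, ∀ a b c : EuclideanSpace ℝ (Fin n),
      Λ a = T x - y → Λ b = x - y → Λ c = x - T x →
      ⟪a, T x - y⟫ ≤ ⟪b, x - y⟫ - (1 - φ) / φ * ⟪c, x - T x⟫ ∧
      Real.sqrt ⟪a, T x - y⟫ ≤ Real.sqrt ⟪b, x - y⟫ := by
  intro x hx a b c ha hb hc
  have hθ0 : 0 < θ := hε.1.trans_le hθ.1
  have hφ0 : 0 < φ := hε.1.trans_le hφ.1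
  have hφ1 : φ ≤ 1 := by linarith [hφ.2, hε.1]
  have hinj := injective_of_coercive hθ0 hΛlow
  obtain ⟨r, hr⟩ : ∃ r, r = R x - x := ⟨_, rfl⟩
  have hTx : T x = x + Λ r := by rw [hT, hr]
  obtain rfl : a = b + r := hinj (by rw [ha, map_add, hb, hTx]; abel)
  obtain rfl : c = -r := hinj (by rw [hc, map_neg, hTx]; abel)
  have hstep : 2 * ⟪r, Λ b⟫ ≤ -‖r‖ ^ 2 := by
    refine two_mul_inner_le_of_norm_add_le ?_
    rw [hb, hr, sub_add_sub_cancel]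
    simpa only [hfix] using hR x hx y hy
  have hmain := inner_map_add_le hΛsa hφ0 (hΛup r) hstep
  have hnonneg : 0 ≤ (1 - φ) / φ * ⟪r, Λ r⟫ := by
    refine mul_nonneg (div_nonneg (sub_nonneg.2 hφ1) hφ0.le) ?_
    rw [real_inner_comm]
    exact le_trans (by positivity) (hΛlow r)
  rw [← ha, ← hb, ← hc, map_neg, inner_neg_neg]
  exact ⟨hmain, Real.sqrt_le_sqrt (by linarith)⟩
end

section
/- Let n be a positive integer, let D be a nonempty closed convex subset of ℝ^n, let ε ∈ (0,1), let {η^k}_{k∈ℕ} be a summable sequence in [0,∞), and let {Λ^k}_{k∈ℕ} be a sequence of self-adjoint positive-definite linear operators on ℝ^n such that for all k: φ^k·Id ⪰ Λ^k ⪰ θ^k·Id with φ^k, θ^k ∈ [ε, 1−ε], and (1+η^k)·Λ^{k+1} ⪰ Λ^k. Let R : D → D be nonexpansive with a fixed point y (R(y) = y), let x^0 ∈ D, and define x^{k+1} := x^k + Λ^k(R(x^k) − x^k), assuming x^k ∈ D for all k. Then for every k, ⟪(Λ^{k+1})⁻¹(x^{k+1} − y), x^{k+1} − y⟫ ≤ (1+η^k)·⟪(Λ^k)⁻¹(x^k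 − y), x^k − y⟫, i.e. the sequence {x^k} is variable-metric quasi-Fejér monotone with respect to the fixed points of R in the metrics induced by (Λ^k)⁻¹. -/
open scoped RealInnerProductSpace

section LoewnerOrder

variable {E : Type*} [NormedAddCommGroup E] [InnerProductSpace ℝ E]

/-- If `0 ⪯ L ⪯ c·M` with `c > 0`, then `M⁻¹ ⪯ c·L⁻¹`, the inverses being given by preimages. -/
theorem inner_preimage_le_of_loewner_le {L M : E →ₗ[ℝ] E} {c : ℝ} (hc : 0 < c)
    (hL : L.IsSymmetric) (hpos : ∀ z, 0 ≤ ⟪L z, z⟫) (hLM : ∀ z, ⟪L z, z⟫ ≤ c * ⟪M z, z⟫)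
    {a d p : E} (ha : M a = p) (hd : L d = p) :
    ⟪a, p⟫ ≤ c * ⟪d, p⟫ := by
  have hsq := hpos (c • d - a)
  have hsymm : ⟪L a, d⟫ = ⟪a, p⟫ := by rw [hL a d, hd]
  have hbound := hLM a
  simp only [map_sub, map_smul, inner_sub_left, inner_sub_right, inner_smul_left,
    inner_smul_right, hd, hsymm, conj_trivial] at hsq
  have hap : ⟪a, p⟫ = ⟪p, a⟫ := real_inner_comm p a
  have hdp : ⟪d, p⟫ = ⟪p, d⟫ := real_inner_comm p d
  rw [ha] at hbound
  rw [hap] at hsq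
  rw [hap, hdp]
  have : 0 ≤ c * (c * ⟪p, d⟫ - ⟪p, a⟫) := by nlinarith
  linarith [nonneg_of_mul_nonneg_right this hc]

/-- A step `v` that does not increase the distance to the origin, relaxed by a symmetric operator
`L ⪯ Id`, does not increase the norm induced by `L⁻¹`. -/
theorem inner_map_add_sub_le {L : E →ₗ[ℝ] E} (hL : L.IsSymmetric)
    (hle : ∀ z, ⟪L z, z⟫ ≤ ‖z‖ ^ 2) {b v : E} (hv : ‖v‖ ≤ ‖L b‖) :
    ⟪b + (v - L b), L (b + (v - L b))⟫ ≤ ⟪b, L b⟫ := by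
  obtain ⟨w, rfl⟩ : ∃ w, v = L b + w := ⟨v - L b, by abel⟩
  have hw := hle w
  have hnorm := norm_add_sq_real (L b) w
  have hsq : ‖L b + w‖ ^ 2 ≤ ‖L b‖ ^ 2 := by gcongr
  have hsymm : ⟪b, L w⟫ = ⟪L b, w⟫ := (hL b w).symm
  rw [add_sub_cancel_left, map_add, inner_add_left, inner_add_right, inner_add_right, hsymm,
    real_inner_comm (L b) w, real_inner_comm (L w) w]
  linarith [real_inner_comm (L b) w]

end LoewnerOrder

/-- The iterates `x^{k+1} = x^k + Λ^k (R(x^k) - x^k)`, with `R`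
nonexpansive on a nonempty closed convex set `D` having a fixed point `y`,
`ε·Id ⪯ θ^k·Id ⪯ Λ^k ⪯ φ^k·Id ⪯ (1-ε)·Id` self-adjoint, and
`(1+η^k)·Λ^{k+1} ⪰ Λ^k` with `{η^k}` summable in `[0,∞)`, form a variable-metric
quasi-Fejér monotone sequence:
`⟪(Λ^{k+1})⁻¹(x^{k+1} - y), x^{k+1} - y⟫ ≤ (1+η^k)·⟪(Λ^k)⁻¹(x^k - y), x^k - y⟫`.
The inverses are encoded by quantifying over preimages. -/
theorem statement4
    (n : ℕ) (hn : 0 < n)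
    (D : Set (EuclideanSpace ℝ (Fin n))) (hD : D.Nonempty)
    (hDclosed : IsClosed D) (hDconvex : Convex ℝ D)
    (ε : ℝ) (hε : ε ∈ Set.Ioo (0 : ℝ) 1)
    (η : ℕ → ℝ) (hη0 : ∀ k, 0 ≤ η k) (hηsum : Summable η)
    (Λ : ℕ → (EuclideanSpace ℝ (Fin n) →ₗ[ℝ] EuclideanSpace ℝ (Fin n)))
    (θ φ : ℕ → ℝ)
    (hθ : ∀ k, θ k ∈ Set.Icc ε (1 - ε)) (hφ : ∀ k, φ k ∈ Set.Icc ε (1 - ε))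
    (hΛsa : ∀ k, ∀ z w, ⟪Λ k z, w⟫ = ⟪z, Λ k w⟫)
    (hΛlow : ∀ k, ∀ z, θ k * ‖z‖ ^ 2 ≤ ⟪Λ k z, z⟫)
    (hΛup : ∀ k, ∀ z, ⟪Λ k z, z⟫ ≤ φ k * ‖z‖ ^ 2)
    (hΛmono : ∀ k, ∀ z, ⟪Λ k z, z⟫ ≤ (1 + η k) * ⟪Λ (k + 1) z, z⟫)
    (R : EuclideanSpace ℝ (Fin n) → EuclideanSpace ℝ (Fin n))
    (hRD : ∀ x ∈ D, R x ∈ D)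
    (hR : ∀ x ∈ D, ∀ y ∈ D, ‖R x - R y‖ ≤ ‖x - y‖)
    (y : EuclideanSpace ℝ (Fin n)) (hy : y ∈ D) (hfix : R y = y)
    (x : ℕ → EuclideanSpace ℝ (Fin n)) (hx0 : x 0 ∈ D) (hxD : ∀ k, x k ∈ D)
    (hrec : ∀ k, x (k + 1) = x k + Λ k (R (x k) - x k)) :
    ∀ k, ∀ a b : EuclideanSpace ℝ (Fin n),
      Λ (k + 1) a = x (k + 1) - y → Λ k b = x k - y →
      ⟪a, x (k + 1) - y⟫ ≤ (1 + η k) * ⟪b, x k - y⟫ := by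
  intro k a b ha hb
  have hΛpos : ∀ z, 0 ≤ ⟪Λ k z, z⟫ := fun z =>
    (mul_nonneg (hε.1.le.trans (hθ k).1) (sq_nonneg _)).trans (hΛlow k z)
  have hΛle : ∀ z, ⟪Λ k z, z⟫ ≤ ‖z‖ ^ 2 := fun z =>
    (hΛup k z).trans (mul_le_of_le_one_left (sq_nonneg _) (by linarith [(hφ k).2, hε.1]))
  have hv : ‖R (x k) - y‖ ≤ ‖Λ k b‖ := by
    simpa only [hb, hfix] using hR (x k) (hxD k) y hy
  have hd : Λ k (b + (R (x k) - y - Λ k b)) = x (k + 1) - y := by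
    rw [hb, sub_sub_sub_cancel_right, map_add, hb, hrec k]
    abel
  have hc : 0 < 1 + η k := by linarith [hη0 k]
  have hstep := inner_map_add_sub_le (hΛsa k) hΛle hv
  rw [hd] at hstep
  rw [← hb]
  exact (inner_preimage_le_of_loewner_le hc (hΛsa k) hΛpos (hΛmono k) ha hd).trans
    (mul_le_mul_of_nonneg_left hstep hc.le)
end

section
/- Let n be a positive integer, let D be a nonempty closed convex subset of ℝ^n, let ε ∈ (0,1), let {η^k}_{k∈ℕ} be a summable sequence in [0,∞), and let {Λ^k}_{k∈ℕ} be a sequence of self-adjoint positive-definite linear operators on ℝ^n such that for all k: φ^k·Id ⪰ Λ^k ⪰ θ^k·Id with φ^k, θ^k ∈ [ε, 1−ε], and (1+η^k)·Λ^{k+1} ⪰ Λ^k. Let R : D → D be nonexpansive with a fixed point y (R(y) = y), let x^0 ∈ D, and define x^{k+1} := x^k + Λ^k(R(x^k) − x^k), assuming x^k ∈ D for all k. Then the sequence of real numbers k ↦ ⟪(Λ^k)⁻¹(x^k − y), x^k − y⟫ converges to a finite limit; in particular, the sequence {x^k} is bounded. -/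
open scoped RealInnerProductSpace

open Filter Topology in
/-- A nonnegative real sequence with `a (k + 1) ≤ (1 + η k) * a k` and `η` nonnegative and
summable converges. -/
theorem exists_tendsto_of_le_one_add_mul {a η : ℕ → ℝ} (ha : ∀ k, 0 ≤ a k)
    (hη0 : ∀ k, 0 ≤ η k) (hη : Summable η) (h : ∀ k, a (k + 1) ≤ (1 + η k) * a k) :
    ∃ L : ℝ, Tendsto a atTop (𝓝 L) := by
  set P : ℕ → ℝ := fun k => ∏ i ∈ Finset.range k, (1 + η i) with hP
  have hpos : ∀ k, 0 < P k := fun k =>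
    Finset.prod_pos fun i _ => by linarith [hη0 i]
  have hsucc : ∀ k, P (k + 1) = P k * (1 + η k) := fun k => Finset.prod_range_succ _ _
  have hPlim : Tendsto P atTop (𝓝 (∏' i, (1 + η i))) :=
    (Real.multipliable_one_add_of_summable hη).hasProd.tendsto_prod_nat
  have hanti : Antitone fun k => a k / P k := by
    refine antitone_nat_of_succ_le fun k => ?_
    rw [div_le_div_iff₀ (hpos _) (hpos _), hsucc]
    nlinarith [mul_le_mul_of_nonneg_right (h k) (hpos k).le]
  have hbdd : BddBelow (Set.range fun k => a k / P k) :=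
    ⟨0, by rintro _ ⟨k, rfl⟩; exact div_nonneg (ha k) (hpos k).le⟩
  refine ⟨_, ((tendsto_atTop_ciInf hanti hbdd).mul hPlim).congr fun k => ?_⟩
  exact div_mul_cancel₀ _ (hpos k).ne'

section VariableMetric

variable {E : Type*} [NormedAddCommGroup E] [InnerProductSpace ℝ E]

/-- Expansion of the quadratic form of a symmetric operator along `q - t • w`. -/
theorem inner_map_sub_smul_self {A : E →ₗ[ℝ] E} (hA : ∀ z w, ⟪A z, w⟫ = ⟪z, A w⟫)
    (q w : E) (t : ℝ) :
    ⟪A (q - t • w), q - t • w⟫ = ⟪A q, q⟫ - 2 * t * ⟪A q, w⟫ + t ^ 2 * ⟪A w, w⟫ := by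
  have hs : ⟪A w, q⟫ = ⟪A q, w⟫ := by rw [hA, real_inner_comm]
  simp only [map_sub, map_smul, inner_sub_left, inner_sub_right, real_inner_smul_left,
    real_inner_smul_right, hs]
  ring

/-- Inversion reverses the Loewner order: if `0 ⪯ A ⪯ c • B` with `c > 0`, then
`B⁻¹ ⪯ c • A⁻¹`. -/
theorem inner_preimage_le_mul {A B : E →ₗ[ℝ] E} (hA : ∀ z w, ⟪A z, w⟫ = ⟪z, A w⟫)
    (hA0 : ∀ z, 0 ≤ ⟪A z, z⟫) {c : ℝ} (hc : 0 < c) (hAB : ∀ z, ⟪A z, z⟫ ≤ c * ⟪B z, z⟫)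
    {p q w : E} (hq : A q = p) (hw : B w = p) : ⟪w, p⟫ ≤ c * ⟪q, p⟫ := by
  have h1 := hA0 (q - c⁻¹ • w)
  rw [inner_map_sub_smul_self hA, hq] at h1
  have h2 := hAB w
  rw [hw] at h2
  rw [real_inner_comm p w, real_inner_comm p q]
  have h3 := mul_le_mul_of_nonneg_left h2 (sq_nonneg c⁻¹)
  have h4 : c⁻¹ ^ 2 * (c * ⟪p, w⟫) = c⁻¹ * ⟪p, w⟫ := by field_simp
  have h5 : c⁻¹ * ⟪p, w⟫ ≤ ⟪p, q⟫ := by linarith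
  rwa [inv_mul_le_iff₀ hc] at h5

/-- One relaxed step does not increase the distance to the fixed point in the metric `A⁻¹`. -/
theorem inner_relaxed_step_le {A : E →ₗ[ℝ] E} (hA : ∀ z w, ⟪A z, w⟫ = ⟪z, A w⟫)
    (hA1 : ∀ z, ⟪A z, z⟫ ≤ ‖z‖ ^ 2) {u v w : E} (hw : A w = u) (huv : ‖v‖ ≤ ‖u‖) :
    ⟪w + (v - u), u + A (v - u)⟫ ≤ ⟪w, u⟫ := by
  have h1 : ⟪w + (v - u), u + A (v - u)⟫
      = ⟪w, u⟫ + 2 * ⟪u, v - u⟫ + ⟪A (v - u), v - u⟫ := by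
    rw [inner_add_left, inner_add_right, inner_add_right, ← hA w, hw,
      real_inner_comm (v - u) u, real_inner_comm (A (v - u))]
    ring
  have h2 : ‖v‖ ^ 2 = ‖u‖ ^ 2 + 2 * ⟪u, v - u⟫ + ‖v - u‖ ^ 2 := by
    rw [← norm_add_sq_real, add_sub_cancel]
  have h3 : ‖v‖ ^ 2 ≤ ‖u‖ ^ 2 := by gcongr
  linarith [hA1 (v - u)]

/-- If `0 ⪯ A ⪯ Id`, then `A⁻¹ ⪰ Id`. -/
theorem norm_sq_le_inner_preimage {A : E →ₗ[ℝ] E} (hA : ∀ z w, ⟪A z, w⟫ = ⟪z, A w⟫)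
    (hA0 : ∀ z, 0 ≤ ⟪A z, z⟫) (hA1 : ∀ z, ⟪A z, z⟫ ≤ ‖z‖ ^ 2) {u w : E} (hw : A w = u) :
    ‖u‖ ^ 2 ≤ ⟪w, u⟫ := by
  have h := inner_preimage_le_mul (B := LinearMap.id) hA hA0 one_pos
    (fun z => by simpa using hA1 z) hw (w := u) rfl
  simpa using h

end VariableMetric

/-- Under the hypotheses of the variable-metric Krasnosel'skiĭ–Mann
scheme (nonexpansive `R : D → D` with fixed point `y`, self-adjoint operators
`ε·Id ⪯ θ^k·Id ⪯ Λ^k ⪯ φ^k·Id ⪯ (1-ε)·Id`, `(1+η^k)·Λ^{k+1} ⪰ Λ^k`, `{η^k}` summable),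
the real sequence `k ↦ ⟪(Λ^k)⁻¹(x^k - y), x^k - y⟫` converges to a finite limit;
in particular `{x^k}` is bounded.  The inverses `(Λ^k)⁻¹` are encoded by a sequence
of preimages `w k` with `Λ k (w k) = x k - y`. -/
theorem statement5
    (n : ℕ) (hn : 0 < n)
    (D : Set (EuclideanSpace ℝ (Fin n))) (hD : D.Nonempty)
    (hDclosed : IsClosed D) (hDconvex : Convex ℝ D)
    (ε : ℝ) (hε : ε ∈ Set.Ioo (0 : ℝ) 1)
    (η : ℕ → ℝ) (hη0 : ∀ k, 0 ≤ η k) (hηsum : Summable η)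
    (Λ : ℕ → (EuclideanSpace ℝ (Fin n) →ₗ[ℝ] EuclideanSpace ℝ (Fin n)))
    (θ φ : ℕ → ℝ)
    (hθ : ∀ k, θ k ∈ Set.Icc ε (1 - ε)) (hφ : ∀ k, φ k ∈ Set.Icc ε (1 - ε))
    (hΛsa : ∀ k, ∀ z w, ⟪Λ k z, w⟫ = ⟪z, Λ k w⟫)
    (hΛlow : ∀ k, ∀ z, θ k * ‖z‖ ^ 2 ≤ ⟪Λ k z, z⟫)
    (hΛup : ∀ k, ∀ z, ⟪Λ k z, z⟫ ≤ φ k * ‖z‖ ^ 2)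
    (hΛmono : ∀ k, ∀ z, ⟪Λ k z, z⟫ ≤ (1 + η k) * ⟪Λ (k + 1) z, z⟫)
    (R : EuclideanSpace ℝ (Fin n) → EuclideanSpace ℝ (Fin n))
    (hRD : ∀ x ∈ D, R x ∈ D)
    (hR : ∀ x ∈ D, ∀ y ∈ D, ‖R x - R y‖ ≤ ‖x - y‖)
    (y : EuclideanSpace ℝ (Fin n)) (hy : y ∈ D) (hfix : R y = y)
    (x : ℕ → EuclideanSpace ℝ (Fin n)) (hx0 : x 0 ∈ D) (hxD : ∀ k, x k ∈ D)
    (hrec : ∀ k, x (k + 1) = x k + Λ k (R (x k) - x k)) :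
    (∀ w : ℕ → EuclideanSpace ℝ (Fin n), (∀ k, Λ k (w k) = x k - y) →
      ∃ L : ℝ, Filter.Tendsto (fun k => ⟪w k, x k - y⟫) Filter.atTop (nhds L)) ∧
    Bornology.IsBounded (Set.range x) := by
  have hφ1 : ∀ k z, ⟪Λ k z, z⟫ ≤ ‖z‖ ^ 2 := fun k z =>
    (hΛup k z).trans (mul_le_of_le_one_left (sq_nonneg _) (by linarith [(hφ k).2, hε.1]))
  have hθ0 : ∀ k, 0 < θ k := fun k => hε.1.trans_le (hθ k).1
  have hΛ0 : ∀ k z, 0 ≤ ⟪Λ k z, z⟫ := fun k z =>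
    (mul_nonneg (hθ0 k).le (sq_nonneg _)).trans (hΛlow k z)
  have hlim : ∀ w : ℕ → EuclideanSpace ℝ (Fin n), (∀ k, Λ k (w k) = x k - y) →
      ∃ L : ℝ, Filter.Tendsto (fun k => ⟪w k, x k - y⟫) Filter.atTop (nhds L) := by
    intro w hw
    refine exists_tendsto_of_le_one_add_mul (fun k => ?_) hη0 hηsum fun k => ?_
    · exact (sq_nonneg _).trans (norm_sq_le_inner_preimage (hΛsa k) (hΛ0 k) (hφ1 k) (hw k))
    · have hstep : x (k + 1) - y = (x k - y) + Λ k (R (x k) - y - (x k - y)) := by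
        rw [hrec, sub_sub_sub_cancel_right]
        abel
      have hq : Λ k (w k + (R (x k) - y - (x k - y))) = x (k + 1) - y := by
        rw [map_add, hw, hstep]
      have hle := inner_relaxed_step_le (hΛsa k) (hφ1 k) (hw k) (v := R (x k) - y)
        (by simpa only [hfix] using hR (x k) (hxD k) y hy)
      rw [← hstep] at hle
      have hc : 0 < 1 + η k := by linarith [hη0 k]
      exact (inner_preimage_le_mul (hΛsa k) (hΛ0 k) hc (hΛmono k) hq (hw (k + 1))).trans
        (mul_le_mul_of_nonneg_left hle hc.le)
  refine ⟨hlim, ?_⟩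
  have hsurj : ∀ k, Function.Surjective (Λ k) := fun k => by
    refine LinearMap.injective_iff_surjective.1 ((injective_iff_map_eq_zero _).2 fun z hz => ?_)
    have h := hΛlow k z
    rw [hz, inner_zero_left] at h
    have hz2 : ‖z‖ ^ 2 = 0 := le_antisymm (nonpos_of_mul_nonpos_right h (hθ0 k)) (sq_nonneg _)
    simpa using hz2
  choose w hw using fun k => hsurj k (x k - y)
  obtain ⟨L, hL⟩ := hlim w hw
  obtain ⟨C, hC⟩ := hL.bddAbove_range
  refine (Metric.isBounded_closedBall (x := y) (r := √C)).subset ?_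
  rintro _ ⟨k, rfl⟩
  rw [mem_closedBall_iff_norm]
  exact Real.le_sqrt_of_sq_le
    ((norm_sq_le_inner_preimage (hΛsa k) (hΛ0 k) (hφ1 k) (hw k)).trans (hC ⟨k, rfl⟩))
end

section
/- Let n be a positive integer, let D be a nonempty closed convex subset of ℝ^n, let ε ∈ (0,1), let {η^k}_{k∈ℕ} be a summable sequence in [0,∞), and let {Λ^k}_{k∈ℕ} be a sequence of self-adjoint positive-definite linear operators on ℝ^n such that for all k: φ^k·Id ⪰ Λ^k ⪰ θ^k·Id with φ^k, θ^k ∈ [ε, 1−ε], and (1+η^k)·Λ^{k+1} ⪰ Λ^k. Let R : D → D be nonexpansive with at least one fixed point, let x^0 ∈ D, and define x^{k+1} := x^k + Λ^k(R(x^k) − x^k), assuming x^k ∈ D for all k. Then the residuals converge to zero: ‖R(x^k) − x^k‖ → 0 as k → ∞. -/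
open scoped RealInnerProductSpace

/-- A quasi-Fejér recursion with summable multiplicative errors forces the decrements to be
summable. -/
theorem summable_of_le_one_add_mul_sub {a c η : ℕ → ℝ} (ha : ∀ k, 0 ≤ a k) (hc : ∀ k, 0 ≤ c k)
    (hη0 : ∀ k, 0 ≤ η k) (hη : Summable η)
    (h : ∀ k, a (k + 1) ≤ (1 + η k) * (a k - c k)) : Summable c := by
  set M : ℝ := Real.exp (∑' k, η k)
  have hM : 0 < M := Real.exp_pos _
  set P : ℕ → ℝ := fun k => ∏ i ∈ Finset.range k, (1 + η i) with hP
  have hPpos : ∀ k, 0 < P k := fun k =>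
    Finset.prod_pos fun i _ => by linarith [hη0 i]
  have hPle : ∀ k, P k ≤ M := fun k => by
    calc P k ≤ ∏ i ∈ Finset.range k, Real.exp (η i) :=
          Finset.prod_le_prod (fun i _ => by linarith [hη0 i])
            fun i _ => by linarith [Real.add_one_le_exp (η i)]
      _ = Real.exp (∑ i ∈ Finset.range k, η i) := (Real.exp_sum _ _).symm
      _ ≤ M := Real.exp_le_exp.2 (hη.sum_le_tsum _ fun i _ => hη0 i)
  have key : ∀ k, ∑ i ∈ Finset.range k, c i / M ≤ a 0 - a k / P k := by
    intro k
    induction k with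
    | zero => simp [hP]
    | succ k ih =>
      have hstep : a (k + 1) / P (k + 1) ≤ a k / P k - c k / P k := by
        rw [← sub_div, div_le_div_iff₀ (hPpos _) (hPpos _)]
        have hsucc : P (k + 1) = P k * (1 + η k) := Finset.prod_range_succ _ _
        rw [hsucc]
        nlinarith [mul_le_mul_of_nonneg_right (h k) (hPpos k).le]
      have hcM : c k / M ≤ c k / P k := div_le_div_of_nonneg_left (hc k) (hPpos k) (hPle k)
      rw [Finset.sum_range_succ]
      linarith
  have hsum : Summable fun k => c k / M :=
    summable_of_sum_range_le (fun k => div_nonneg (hc k) hM.le) fun k =>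
      (key k).trans (sub_le_self _ (div_nonneg (ha k) (hPpos k).le))
  simpa [div_mul_cancel₀ _ hM.ne'] using hsum.mul_right M

/-- Inversion reverses the Loewner order, up to a scalar factor: if `A ⪯ c • B` with `A`
positive semidefinite and symmetric, then `⟪B⁻¹ z, z⟫ ≤ c * ⟪A⁻¹ z, z⟫`, where `u = B⁻¹ z` and
`w = A⁻¹ z`. -/
theorem inner_le_mul_inner_of_loewner_le {E : Type*} [NormedAddCommGroup E]
    [InnerProductSpace ℝ E] {A B : E →ₗ[ℝ] E} {c : ℝ} (hc : 0 < c)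
    (hsa : ∀ z w, ⟪A z, w⟫ = ⟪z, A w⟫) (hpos : ∀ z, 0 ≤ ⟪A z, z⟫)
    (hAB : ∀ z, ⟪A z, z⟫ ≤ c * ⟪B z, z⟫) {u w z : E} (hu : B u = z) (hw : A w = z) :
    ⟪u, z⟫ ≤ c * ⟪w, z⟫ := by
  have h1 := hpos (u - c • w)
  have h2 := hAB u
  have h3 : ⟪A u, w⟫ = ⟪u, z⟫ := by rw [hsa, hw]
  simp only [map_sub, map_smul, inner_sub_left, inner_sub_right, real_inner_smul_left,
    real_inner_smul_right, hw, h3, real_inner_comm u z, real_inner_comm w z] at h1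
  rw [hu, real_inner_comm] at h2
  have h4 : 0 ≤ c * (c * ⟪w, z⟫ - ⟪u, z⟫) := by
    simp only [real_inner_comm] at h1 h2 ⊢
    linarith
  linarith [nonneg_of_mul_nonneg_right h4 hc]

/-- Under the hypotheses of the variable-metric Krasnosel'skiĭ–Mann
scheme (nonexpansive `R : D → D` with at least one fixed point, self-adjoint operators
`ε·Id ⪯ θ^k·Id ⪯ Λ^k ⪯ φ^k·Id ⪯ (1-ε)·Id`, `(1+η^k)·Λ^{k+1} ⪰ Λ^k`, `{η^k}` summable),
the residuals of the iterates `x^{k+1} = x^k + Λ^k (R(x^k) - x^k)` converge to zero: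
`‖R(x^k) - x^k‖ → 0`. -/
theorem statement6
    (n : ℕ) (hn : 0 < n)
    (D : Set (EuclideanSpace ℝ (Fin n))) (hD : D.Nonempty)
    (hDclosed : IsClosed D) (hDconvex : Convex ℝ D)
    (ε : ℝ) (hε : ε ∈ Set.Ioo (0 : ℝ) 1)
    (η : ℕ → ℝ) (hη0 : ∀ k, 0 ≤ η k) (hηsum : Summable η)
    (Λ : ℕ → (EuclideanSpace ℝ (Fin n) →ₗ[ℝ] EuclideanSpace ℝ (Fin n)))
    (θ φ : ℕ → ℝ)
    (hθ : ∀ k, θ k ∈ Set.Icc ε (1 - ε)) (hφ : ∀ k, φ k ∈ Set.Icc ε (1 - ε))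
    (hΛsa : ∀ k, ∀ z w, ⟪Λ k z, w⟫ = ⟪z, Λ k w⟫)
    (hΛlow : ∀ k, ∀ z, θ k * ‖z‖ ^ 2 ≤ ⟪Λ k z, z⟫)
    (hΛup : ∀ k, ∀ z, ⟪Λ k z, z⟫ ≤ φ k * ‖z‖ ^ 2)
    (hΛmono : ∀ k, ∀ z, ⟪Λ k z, z⟫ ≤ (1 + η k) * ⟪Λ (k + 1) z, z⟫)
    (R : EuclideanSpace ℝ (Fin n) → EuclideanSpace ℝ (Fin n))
    (hRD : ∀ x ∈ D, R x ∈ D)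
    (hR : ∀ x ∈ D, ∀ y ∈ D, ‖R x - R y‖ ≤ ‖x - y‖)
    (hfixne : ∃ y ∈ D, R y = y)
    (x : ℕ → EuclideanSpace ℝ (Fin n)) (hx0 : x 0 ∈ D) (hxD : ∀ k, x k ∈ D)
    (hrec : ∀ k, x (k + 1) = x k + Λ k (R (x k) - x k)) :
    Filter.Tendsto (fun k => ‖R (x k) - x k‖) Filter.atTop (nhds 0) := by
  obtain ⟨hε0, -⟩ := hε
  obtain ⟨y, hyD, hy⟩ := hfixne
  have hpos : ∀ k z, 0 ≤ ⟪Λ k z, z⟫ := fun k z =>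
    (mul_nonneg (hε0.le.trans (hθ k).1) (sq_nonneg _)).trans (hΛlow k z)
  have hinj : ∀ k, Function.Injective (Λ k) := fun k => by
    refine (injective_iff_map_eq_zero _).2 fun z hz => ?_
    have h1 := hΛlow k z
    rw [hz, inner_zero_left] at h1
    have h2 : 0 < θ k := hε0.trans_le (hθ k).1
    have h3 : ‖z‖ ^ 2 ≤ 0 := by nlinarith [sq_nonneg ‖z‖]
    simpa using le_antisymm h3 (sq_nonneg _)
  have hsurj : ∀ k, Function.Surjective (Λ k) := fun k =>
    LinearMap.injective_iff_surjective.1 (hinj k)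
  choose u hu using fun k => hsurj k (x k - y)
  have hnonneg : ∀ k, 0 ≤ ⟪u k, x k - y⟫ := fun k => by
    rw [← hu k, real_inner_comm]
    exact hpos k _
  have hdecr : ∀ k, ⟪u (k + 1), x (k + 1) - y⟫ ≤
      (1 + η k) * (⟪u k, x k - y⟫ - ε * ‖R (x k) - x k‖ ^ 2) := by
    intro k
    set r := R (x k) - x k with hr
    have hη1 : 0 < 1 + η k := by linarith [hη0 k]
    have hw : Λ k (u k + r) = x (k + 1) - y := by
      rw [map_add, hu, hrec]
      abel
    refine (inner_le_mul_inner_of_loewner_le hη1 (hΛsa k) (hpos k) (hΛmono k)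
      (hu (k + 1)) hw).trans (mul_le_mul_of_nonneg_left ?_ hη1.le)
    have hne : ‖x k - y + r‖ ^ 2 ≤ ‖x k - y‖ ^ 2 := by
      have h1 := hR (x k) (hxD k) y hyD
      have h2 : x k - y + r = R (x k) - R y := by
        rw [hy, hr]
        abel
      rw [h2]
      exact pow_le_pow_left₀ (norm_nonneg _) h1 2
    rw [norm_add_sq_real] at hne
    have hup := hΛup k r
    have hφr : φ k * ‖r‖ ^ 2 ≤ (1 - ε) * ‖r‖ ^ 2 :=
      mul_le_mul_of_nonneg_right (hφ k).2 (sq_nonneg _)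
    have hexp : ⟪u k + r, x (k + 1) - y⟫ =
        ⟪u k, x k - y⟫ + 2 * ⟪x k - y, r⟫ + ⟪Λ k r, r⟫ := by
      rw [← hw, map_add, hu, inner_add_left, inner_add_right, inner_add_right,
        ← hΛsa k (u k) r, hu, real_inner_comm (x k - y) r, real_inner_comm r (Λ k r)]
      ring
    rw [hexp]
    linarith
  have hsum := summable_of_le_one_add_mul_sub hnonneg
    (fun k => mul_nonneg hε0.le (sq_nonneg _)) hη0 hηsum hdecr
  have hlim := ((summable_mul_left_iff hε0.ne').1 hsum).tendsto_atTop_zero.sqrt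
  simpa using hlim
end
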